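/- Suppose ℂ[x,x⁻¹] has an invariant subspace other than 0 and ℂ[x,x⁻¹] (i.e. j₀M is reducible). Then there is a unique irreducible invariant subspace S, i.e. a nonzero invariant subspace having no invariant subspaces other than 0 and itself, and any other such coincides with S. Moreover multiplication by x is injective on S (so S has full support), and multiplication by x is locally nilpotent on the quotient ℂ[x,x⁻¹]/S (so the quotient module is supported at the origin and lies in the category O⁻, the Fourier dual of category O). -/

import Mathlib

noncomputable section

/-- The Laurent polynomial ring `ℂ[x,x⁻¹]`, viewed as the space of finitely supported
coefficient functions `ℤ →₀ ℂ`; the monomial `x^n` is `Finsupp.single n 1`. -/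
abbrev LaurentC : Type := ℤ →₀ ℂ

/-- The `ℂ`-linear endomorphism of `ℂ[x,x⁻¹]` determined by its values on the monomials
`x^n`, `n : ℤ`. -/
noncomputable def onMonomials (g : ℤ → LaurentC) : LaurentC →ₗ[ℂ] LaurentC :=
  Finsupp.lsum ℂ fun n => LinearMap.toSpanSingleton ℂ LaurentC (g n)

/-- Multiplication by `x`. -/
noncomputable def mulX : LaurentC →ₗ[ℂ] LaurentC :=
  onMonomials fun n => Finsupp.single (n + 1) 1

/-- The operator `s_i : x^n ↦ λ^{i n} x^n`. -/
noncomputable def sOp (lam : ℂ) (i : ℕ) : LaurentC →ₗ[ℂ] LaurentC :=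
  onMonomials fun n => Finsupp.single n (lam ^ ((i : ℤ) * n))

/-- The Dunkl operator
`D(x^n) = n x^{n-1} + p·x^n + Σ_{i=1}^{m-1} (2 c_i (1-λ^{in})/(1-λ^i)) x^{n-1}`. -/
noncomputable def dunkl (m : ℕ) (lam : ℂ) (c : ℕ → ℂ) (p : LaurentC) : LaurentC →ₗ[ℂ] LaurentC :=
  onMonomials fun n =>
    Finsupp.mapDomain (· + n) p +
      ((n : ℂ) + ∑ i ∈ Finset.Icc 1 (m - 1),
          2 * c i * (1 - lam ^ ((i : ℤ) * n)) / (1 - lam ^ (i : ℤ))) • Finsupp.single (n - 1) 1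

/-- A subspace `N ⊆ ℂ[x,x⁻¹]` is an invariant subspace if it is closed under multiplication
by `x`, under `s_1`, and under the Dunkl operator `D`; invariant subspaces are exactly the
submodules of the rational Cherednik algebra module `j₀M`. -/
def IsInvariantSubspace (m : ℕ) (lam : ℂ) (c : ℕ → ℂ) (p : LaurentC) (N : Submodule ℂ LaurentC) : Prop :=
  (∀ f ∈ N, mulX f ∈ N) ∧ (∀ f ∈ N, sOp lam 1 f ∈ N) ∧ (∀ f ∈ N, dunkl m lam c p f ∈ N)

/-- The subspace `x^k ℂ[x]`: the span of the monomials `x^n` with `n ≥ k`. -/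
noncomputable def tailSpace (k : ℤ) : Submodule ℂ LaurentC :=
  Submodule.span ℂ {f : LaurentC | ∃ n : ℤ, k ≤ n ∧ f = Finsupp.single n 1}

/-- A nonzero invariant subspace with no invariant subspaces other than `0` and itself. -/
def IsIrreducibleInvariant (m : ℕ) (lam : ℂ) (c : ℕ → ℂ) (p : LaurentC)
    (S : Submodule ℂ LaurentC) : Prop :=
  S ≠ ⊥ ∧ IsInvariantSubspace m lam c p S ∧
    ∀ N : Submodule ℂ LaurentC, N ≤ S → IsInvariantSubspace m lam c p N → N = ⊥ ∨ N = S

def aCoef (m : ℕ) (lam : ℂ) (c : ℕ → ℂ) (n : ℤ) : ℂ :=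
  (n : ℂ) + ∑ i ∈ Finset.Icc 1 (m - 1),
          2 * c i * (1 - lam ^ ((i : ℤ) * n)) / (1 - lam ^ (i : ℤ))

def shiftL (k : ℤ) : LaurentC →ₗ[ℂ] LaurentC :=
  onMonomials fun n => Finsupp.single (n + k) 1

def diagL (a : ℤ → ℂ) : LaurentC →ₗ[ℂ] LaurentC :=
  onMonomials fun n => Finsupp.single n (a n)

theorem onMonomials_single (g : ℤ → LaurentC) (n : ℤ) (a : ℂ) :
    onMonomials g (Finsupp.single n a) = a • g n := by
  simp [onMonomials]

theorem lhom_ext {A B : LaurentC →ₗ[ℂ] LaurentC}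
    (h : ∀ n : ℤ, A (Finsupp.single n 1) = B (Finsupp.single n 1)) : A = B := by
  apply Finsupp.lhom_ext
  intro n b
  have : (Finsupp.single n b : LaurentC) = b • Finsupp.single n 1 := by simp
  rw [this, map_smul, map_smul, h]

theorem shiftL_apply (k : ℤ) (f : LaurentC) (n : ℤ) : shiftL k f n = f (n - k) := by
  have : (Finsupp.lapply n).comp (shiftL k) = (Finsupp.lapply (n - k) : LaurentC →ₗ[ℂ] ℂ) := by
    apply Finsupp.lhom_ext
    intro j b
    simp only [LinearMap.comp_apply, shiftL, onMonomials_single, Finsupp.lapply_apply,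
      Finsupp.smul_apply, Finsupp.single_apply, smul_eq_mul]
    by_cases h : j + k = n
    · rw [if_pos h, if_pos (by omega)]; simp
    · rw [if_neg h, if_neg (by omega)]; simp
  exact LinearMap.congr_fun this f

theorem diagL_apply (a : ℤ → ℂ) (f : LaurentC) (n : ℤ) : diagL a f n = a n * f n := by
  have : (Finsupp.lapply n).comp (diagL a) = a n • (Finsupp.lapply n : LaurentC →ₗ[ℂ] ℂ) := by
    apply Finsupp.lhom_ext
    intro j b
    simp only [LinearMap.comp_apply, diagL, onMonomials_single, Finsupp.lapply_apply,
      Finsupp.smul_apply, Finsupp.single_apply, smul_eq_mul, LinearMap.smul_apply]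
    by_cases h : j = n
    · subst h; simp [mul_comm]
    · rw [if_neg h, if_neg h]; simp
  exact LinearMap.congr_fun this f

theorem shiftL_shiftL (k l : ℤ) (f : LaurentC) : shiftL k (shiftL l f) = shiftL (k + l) f := by
  ext n
  simp only [shiftL_apply]
  congr 1; ring

theorem sOp_apply (lam : ℂ) (f : LaurentC) (n : ℤ) : sOp lam 1 f n = lam ^ n * f n := by
  have : sOp lam 1 = diagL fun n => lam ^ n := by
    simp [sOp, diagL]
  rw [this, diagL_apply]

theorem mulX_eq : mulX = shiftL 1 := rfl

theorem mulX_iter (n : ℕ) (f : LaurentC) : (⇑mulX)^[n] f = shiftL n f := by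
  induction n with
  | zero => ext j; simp [shiftL_apply]
  | succ k ih =>
    rw [Function.iterate_succ_apply', ih, mulX_eq, shiftL_shiftL]
    congr 2; push_cast; ring

theorem dunkl_single (m : ℕ) (lam : ℂ) (c : ℕ → ℂ) (p : LaurentC) (k n : ℤ) :
    dunkl m lam c p (Finsupp.single k 1) n
      = p (n - k) + if n = k - 1 then aCoef m lam c k else 0 := by
  rw [dunkl, onMonomials_single, one_smul, Finsupp.add_apply]
  congr 1
  · have := Finsupp.mapDomain_apply (add_left_injective k) p (n - k)
    simpa using this
  · rw [Finsupp.smul_apply, Finsupp.single_apply, smul_eq_mul]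
    by_cases h : n = k - 1
    · rw [if_pos h, if_pos h.symm, mul_one]; rfl
    · rw [if_neg h, if_neg (Ne.symm h), mul_zero]

theorem dunkl_eq (m : ℕ) (lam : ℂ) (c : ℕ → ℂ) (p : LaurentC) (f : LaurentC) :
    dunkl m lam c p f = (∑ j ∈ p.support, p j • shiftL j f)
      + shiftL (-1) (diagL (aCoef m lam c) f) := by
  have : dunkl m lam c p = (∑ j ∈ p.support, p j • shiftL j)
      + (shiftL (-1)).comp (diagL (aCoef m lam c)) := by
    apply lhom_ext
    intro k
    ext n
    rw [dunkl_single]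
    simp only [LinearMap.add_apply, LinearMap.sum_apply, LinearMap.smul_apply,
      LinearMap.comp_apply, Finsupp.add_apply, Finsupp.finsetSum_apply, Finsupp.smul_apply,
      shiftL_apply, diagL_apply, smul_eq_mul, Finsupp.single_apply]
    congr 1
    · rw [Finset.sum_eq_single (n - k)]
      · simp
      · intro b _ hb
        rw [if_neg (by omega), mul_zero]
      · intro h
        simp [Finsupp.notMem_support_iff.1 h]
    · by_cases h : n = k - 1
      · subst h; simp
      · rw [if_neg h, if_neg (by omega), mul_zero]
  rw [this]
  simp [LinearMap.sum_apply]

theorem mem_tail (k : ℤ) (f : LaurentC) : f ∈ tailSpace k ↔ ∀ n < k, f n = 0 := by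
  have : tailSpace k = Finsupp.supported ℂ ℂ (Set.Ici k) := by
    rw [Finsupp.supported_eq_span_single, tailSpace]
    congr 1
    ext g
    simp [eq_comm]
  rw [this, Finsupp.mem_supported']
  simp

theorem single_mem_tail (k : ℤ) : (Finsupp.single k 1 : LaurentC) ∈ tailSpace k :=
  Submodule.subset_span ⟨k, le_rfl, rfl⟩

theorem tail_step (k : ℤ) (N : Submodule ℂ LaurentC) (h : tailSpace k ≤ N) (f : LaurentC)
    (hf : f ∈ N) (h0 : ∀ n < k - 1, f n = 0) (h1 : f (k - 1) ≠ 0) : tailSpace (k - 1) ≤ N := by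
  have key : ∀ g : LaurentC, (∀ n < k - 1, g n = 0) →
      g - (g (k - 1) / f (k - 1)) • f ∈ N := by
    intro g hg
    apply h
    rw [mem_tail]
    intro n hn
    rw [Finsupp.sub_apply, Finsupp.smul_apply, smul_eq_mul]
    rcases lt_or_eq_of_le (show n ≤ k - 1 by omega) with h' | h'
    · rw [hg n h', h0 n h']; simp
    · subst h'; field_simp; simp
  intro g hg
  have := N.add_mem (key g ((mem_tail _ _).1 hg)) (N.smul_mem (g (k - 1) / f (k - 1)) hf)
  simpa using this

theorem shift_mem {m : ℕ} {lam : ℂ} {c : ℕ → ℂ} {p : LaurentC} {N : Submodule ℂ LaurentC}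
    (hN : IsInvariantSubspace m lam c p N) {k : ℤ} (hk : 0 ≤ k) {f : LaurentC} (hf : f ∈ N) :
    shiftL k f ∈ N := by
  obtain ⟨n, rfl⟩ := Int.eq_ofNat_of_zero_le hk
  rw [← mulX_iter]
  induction n with
  | zero => exact hf
  | succ n ih =>
    rw [Function.iterate_succ_apply']
    exact hN.1 _ (ih (by positivity))

theorem aCoef_sub {m : ℕ} {lam : ℂ} (hlam : IsPrimitiveRoot lam m) (c : ℕ → ℂ) {n n' : ℤ}
    (h : (m : ℤ) ∣ n - n') : aCoef m lam c n - aCoef m lam c n' = (n : ℂ) - n' := by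
  rw [aCoef, aCoef, add_sub_add_comm, ← Finset.sum_sub_distrib, Finset.sum_eq_zero, add_zero]
  intro i hi
  by_cases h0 : lam = 0
  · have hm : m = 0 := by
      by_contra hm
      have := hlam.pow_eq_one
      rw [h0, zero_pow hm] at this
      exact zero_ne_one this
    subst hm
    simp at hi
  have : lam ^ ((i : ℤ) * n) = lam ^ ((i : ℤ) * n') := by
    obtain ⟨d, hd⟩ := h
    have e : (i : ℤ) * n = i * n' + m * (d * i) := by
      rw [show n = n' + m * d by linarith]; ring
    rw [e, zpow_add₀ h0, zpow_mul lam (m : ℤ), zpow_natCast, hlam.pow_eq_one, one_zpow, mul_one]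
  rw [this, sub_self]

theorem exists_shift_diag {m : ℕ} {lam : ℂ} {c : ℕ → ℂ} (p : LaurentC) :
    ∃ K : ℤ, 0 ≤ K ∧ ∀ N : Submodule ℂ LaurentC, IsInvariantSubspace m lam c p N → ∀ f ∈ N,
      shiftL K (diagL (aCoef m lam c) f) ∈ N := by
  obtain ⟨B, hB⟩ := p.support.bddBelow
  refine ⟨max 0 (-B), le_max_left _ _, fun N hN f hf => ?_⟩
  set K := max 0 (-B)
  have h1 : shiftL (K + 1) (dunkl m lam c p f) ∈ N :=
    shift_mem hN (by have := le_max_left 0 (-B); omega) (hN.2.2 f hf)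
  rw [dunkl_eq, map_add, shiftL_shiftL, add_neg_cancel_right] at h1
  refine (N.add_mem_iff_right ?_).1 h1
  rw [map_sum]
  refine N.sum_mem fun j hj => ?_
  rw [map_smul, shiftL_shiftL]
  refine N.smul_mem _ (shift_mem hN ?_ hf)
  have := hB hj
  have := le_max_right 0 (-B)
  omega

theorem exists_tail {m : ℕ} {lam : ℂ} (hm : 2 ≤ m) (hlam : IsPrimitiveRoot lam m)
    {c : ℕ → ℂ} {p : LaurentC} {N : Submodule ℂ LaurentC}
    (hN : IsInvariantSubspace m lam c p N) (h0 : N ≠ ⊥) : ∃ k, tailSpace k ≤ N := by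
  have hl0 : lam ≠ 0 := hlam.ne_zero (by omega)
  obtain ⟨K, hK, hKN⟩ := exists_shift_diag (m := m) (lam := lam) (c := c) p
  obtain ⟨f0, hf0, hf0'⟩ := N.ne_bot_iff.1 h0
  have key : ∀ s : ℕ, ∀ f ∈ N, f ≠ 0 → f.support.card ≤ s →
      ∃ n : ℤ, Finsupp.single n 1 ∈ N := by
    intro s
    induction s with
    | zero =>
      intro f _ hf hs
      simp at hs
      exact absurd hs hf
    | succ s ih =>
      intro f hfN hf hs
      obtain ⟨n, hn⟩ := Finsupp.support_nonempty_iff.2 hf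
      have hn' := Finsupp.mem_support_iff.1 hn
      by_cases hex : ∃ n' ∈ f.support, n' ≠ n
      · obtain ⟨n', hn1, hne⟩ := hex
        have hn1' := Finsupp.mem_support_iff.1 hn1
        have red : ∀ b : ℤ → ℂ, b n' ≠ b n →
            (diagL b f - b n • f ≠ 0 ∧ (diagL b f - b n • f).support.card ≤ s) := by
          intro b hb
          have hv : ∀ j, (diagL b f - b n • f) j = (b j - b n) * f j := by
            intro j
            rw [Finsupp.sub_apply, diagL_apply, Finsupp.smul_apply, smul_eq_mul]; ring
          constructor
          · intro h
            have := hv n'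
            rw [h] at this
            exact mul_ne_zero (sub_ne_zero.2 hb) hn1' this.symm
          · have : (diagL b f - b n • f).support ⊂ f.support := by
              rw [Finset.ssubset_iff_of_subset]
              · refine ⟨n, hn, ?_⟩
                rw [Finsupp.notMem_support_iff, hv]; simp
              · intro j hj
                rw [Finsupp.mem_support_iff, hv] at hj
                exact Finsupp.mem_support_iff.2 (right_ne_zero_of_mul hj)
            have := Finset.card_lt_card this
            omega
        by_cases hl : lam ^ n' = lam ^ n
        · have hd : (m : ℤ) ∣ n' - n := by
            rw [← hlam.zpow_eq_one_iff_dvd, zpow_sub₀ hl0, hl, div_self (zpow_ne_zero _ hl0)]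
          have hb : aCoef m lam c n' ≠ aCoef m lam c n := by
            intro h
            have := aCoef_sub hlam c hd
            rw [h, sub_self] at this
            exact hne (by exact_mod_cast (sub_eq_zero.1 this.symm))
          obtain ⟨r1, r2⟩ := red _ hb
          set g := diagL (aCoef m lam c) f - aCoef m lam c n • f with hg
          have hgN : shiftL K g ∈ N := by
            rw [hg, map_sub, map_smul]
            exact N.sub_mem (hKN N hN f hfN) (N.smul_mem _ (shift_mem hN hK hfN))
          refine ih _ hgN ?_ ?_
          · intro h
            apply r1
            ext j
            have := shiftL_apply K g (j + K)
            rw [h] at this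
            simpa using this.symm
          · refine le_trans ?_ r2
            refine Finset.card_le_card_of_injOn (fun j => j - K) ?_ ?_
            · intro j hj
              simp only [Finset.mem_coe, Finsupp.mem_support_iff, shiftL_apply] at hj ⊢
              exact hj
            · intro a _ b _ h
              simpa using h
        · obtain ⟨r1, r2⟩ := red (fun n => lam ^ n) hl
          refine ih _ ?_ r1 r2
          refine N.sub_mem ?_ (N.smul_mem _ hfN)
          have : diagL (fun n => lam ^ n) f = sOp lam 1 f := by
            ext j; rw [sOp_apply, diagL_apply]
          rw [this]
          exact hN.2.1 f hfN
      · push Not at hex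
        refine ⟨n, ?_⟩
        have : (Finsupp.single n 1 : LaurentC) = (f n)⁻¹ • f := by
          ext j
          rw [Finsupp.smul_apply, smul_eq_mul, Finsupp.single_apply]
          by_cases h : n = j
          · subst h; rw [if_pos rfl, inv_mul_cancel₀ hn']
          · rw [if_neg h, Finsupp.notMem_support_iff.1 (fun hj => h (hex j hj).symm), mul_zero]
        rw [this]
        exact N.smul_mem _ hfN
  obtain ⟨n, hn⟩ := key _ f0 hf0 hf0' le_rfl
  refine ⟨n, Submodule.span_le.2 ?_⟩
  rintro _ ⟨j, hj, rfl⟩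
  have := shift_mem hN (sub_nonneg.2 hj) hn
  rw [shiftL, onMonomials_single, one_smul, add_sub_cancel] at this
  exact this

theorem tail_anti {k l : ℤ} (h : k ≤ l) : tailSpace l ≤ tailSpace k := by
  intro f hf
  rw [mem_tail] at *
  exact fun n hn => hf n (by omega)

theorem eq_top_of_step {N : Submodule ℂ LaurentC} (h : ∃ k, tailSpace k ≤ N)
    (hs : ∀ k, tailSpace k ≤ N → tailSpace (k - 1) ≤ N) : N = ⊤ := by
  obtain ⟨k, hk⟩ := h
  have : ∀ d : ℕ, tailSpace (k - d) ≤ N := by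
    intro d
    induction d with
    | zero => simpa using hk
    | succ d ih =>
      have := hs _ ih
      rwa [show k - (d : ℤ) - 1 = k - (d + 1 : ℕ) by push_cast; ring] at this
  rw [eq_top_iff]
  intro f _
  obtain ⟨B, hB⟩ := f.support.bddBelow
  refine this (k - B).toNat ((mem_tail _ _).2 fun n hn => ?_)
  by_contra hc
  have := hB (Finsupp.mem_support_iff.2 hc)
  omega

/-- If `j₀M` is reducible, it has a unique irreducible submodule `S`; multiplication by `x`
is injective on `S` (so `S` has full support) and locally nilpotent on the quotient (so the
quotient lies in the category `O⁻`). -/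
theorem unique_irreducible_invariant_subspace
    (m : ℕ) (hm : 2 ≤ m) (lam : ℂ) (hlam : IsPrimitiveRoot lam m)
    (c : ℕ → ℂ) (p : LaurentC) (hp : ∀ n : ℤ, ¬ ((m : ℤ) ∣ (n + 1)) → p n = 0)
    (hred : ∃ N : Submodule ℂ LaurentC, IsInvariantSubspace m lam c p N ∧ N ≠ ⊥ ∧ N ≠ ⊤) :
    ∃ S : Submodule ℂ LaurentC, IsIrreducibleInvariant m lam c p S ∧
      (∀ S' : Submodule ℂ LaurentC, IsIrreducibleInvariant m lam c p S' → S' = S) ∧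
      (∀ f ∈ S, mulX f = 0 → f = 0) ∧
      (∀ f : LaurentC, ∃ n : ℕ, (⇑mulX)^[n] f ∈ S) := by
  obtain ⟨N0, hN0, hN0b, hN0t⟩ := hred
  -- no terms of `p` below `-1`
  have hpos : ∀ j < -1, p j = 0 := by
    by_contra hcon
    push Not at hcon
    obtain ⟨j1, hj1, hpj1⟩ := hcon
    obtain ⟨j0, hj0, hmin⟩ := p.support.exists_min_image id ⟨j1, Finsupp.mem_support_iff.2 hpj1⟩
    have hle : j0 ≤ j1 := hmin _ (Finsupp.mem_support_iff.2 hpj1)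
    refine hN0t (eq_top_of_step (exists_tail hm hlam hN0 hN0b) fun k hk => ?_)
    have hx := hN0.2.2 _ (hk (single_mem_tail k))
    refine tail_step k N0 hk _ (shift_mem hN0 (k := -j0 - 1) (by omega) hx) ?_ ?_
    · intro n hn
      rw [shiftL_apply, dunkl_single, if_neg (by omega), add_zero]
      by_contra hc
      have := hmin _ (Finsupp.mem_support_iff.2 hc)
      simp only [id] at this
      omega
    · rw [shiftL_apply, dunkl_single, if_neg (by omega), add_zero]
      rw [show k - 1 - (-j0 - 1) - k = j0 by ring]
      exact Finsupp.mem_support_iff.1 hj0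
  have step : ∀ N, IsInvariantSubspace m lam c p N → ∀ k, p (-1) + aCoef m lam c k ≠ 0 →
      tailSpace k ≤ N → tailSpace (k - 1) ≤ N := by
    intro N hN k hu hk
    refine tail_step k N hk _ (hN.2.2 _ (hk (single_mem_tail k))) ?_ ?_
    · intro n hn
      rw [dunkl_single, if_neg (by omega), add_zero]
      exact hpos _ (by omega)
    · rw [dunkl_single, if_pos rfl, show k - 1 - k = -1 by ring]
      exact hu
  have hZne : ∃ k, p (-1) + aCoef m lam c k = 0 := by
    by_contra hcon
    push Not at hcon
    exact hN0t (eq_top_of_step (exists_tail hm hlam hN0 hN0b) fun k hk => step N0 hN0 k (hcon k) hk)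
  have hZfin : {k : ℤ | p (-1) + aCoef m lam c k = 0}.Finite := by
    haveI : NeZero m := ⟨by omega⟩
    refine Set.Finite.of_finite_image (f := fun k : ℤ => (k : ZMod m)) (Set.toFinite _) ?_
    intro a ha b hb hab
    have hd : (m : ℤ) ∣ b - a := (ZMod.intCast_eq_intCast_iff_dvd_sub a b m).1 hab
    have := aCoef_sub hlam c hd
    simp only [Set.mem_setOf_eq] at ha hb
    have h2 : (b : ℂ) - a = 0 := by rw [← this]; linear_combination hb - ha
    exact_mod_cast (sub_eq_zero.1 h2).symm
  obtain ⟨k0, hk0, hmax⟩ := Set.exists_max_image _ id hZfin hZne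
  simp only [Set.mem_setOf_eq, id] at hk0 hmax
  have hinv : IsInvariantSubspace m lam c p (tailSpace k0) := by
    refine ⟨fun f hf => ?_, fun f hf => ?_, fun f hf => ?_⟩
    · rw [mem_tail] at *
      intro n hn
      rw [mulX_eq, shiftL_apply]
      exact hf _ (by omega)
    · rw [mem_tail] at *
      intro n hn
      rw [sOp_apply, hf n hn, mul_zero]
    · have : tailSpace k0 ≤ (tailSpace k0).comap (dunkl m lam c p) := by
        refine Submodule.span_le.2 ?_
        rintro _ ⟨j, hj, rfl⟩
        change _ ∈ tailSpace k0
        rw [mem_tail]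
        intro n hn
        rw [dunkl_single]
        by_cases h : n = j - 1
        · have : j = k0 := by omega
          subst this
          rw [if_pos h, h, show j - 1 - j = -1 by ring, hk0]
        · rw [if_neg h, add_zero]
          exact hpos _ (by omega)
      exact this hf
  have hleast : ∀ N, IsInvariantSubspace m lam c p N → N ≠ ⊥ → tailSpace k0 ≤ N := by
    intro N hN hNb
    obtain ⟨k, hk⟩ := exists_tail hm hlam hN hNb
    have : ∀ d : ℕ, tailSpace (max (k - d) k0) ≤ N := by
      intro d
      induction d with
      | zero => exact (tail_anti (by simp)).trans hk
      | succ d ih =>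
        by_cases hd : k - d ≤ k0
        · rw [max_eq_right hd] at ih
          rwa [max_eq_right (by push_cast; omega)]
        · rw [max_eq_left (by omega)] at ih
          have h1 : p (-1) + aCoef m lam c (k - d) ≠ 0 := fun h => hd (hmax _ h)
          have h2 := step N hN _ h1 ih
          rwa [max_eq_left (by push_cast; omega),
            show k - ((d + 1 : ℕ) : ℤ) = k - d - 1 by push_cast; ring]
    have h3 := this (k - k0).toNat
    rwa [max_eq_right (by omega)] at h3
  have hSb : tailSpace k0 ≠ ⊥ := by
    intro h
    have h1 := single_mem_tail k0
    rw [h, Submodule.mem_bot] at h1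
    simp at h1
  refine ⟨tailSpace k0, ⟨hSb, hinv, fun N hle hN => ?_⟩, fun S' hS' => ?_, fun f _ h => ?_,
    fun f => ?_⟩
  · by_cases hNb : N = ⊥
    · exact Or.inl hNb
    · exact Or.inr (le_antisymm hle (hleast N hN hNb))
  · rcases hS'.2.2 _ (hleast S' hS'.2.1 hS'.1) hinv with h | h
    · exact absurd h hSb
    · exact h.symm
  · ext j
    have := shiftL_apply 1 f (j + 1)
    rw [← mulX_eq, h] at this
    simpa using this.symm
  · obtain ⟨B, hB⟩ := f.support.bddBelow
    refine ⟨(k0 - B).toNat, ?_⟩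
    rw [mulX_iter, mem_tail]
    intro n hn
    rw [shiftL_apply]
    by_contra hc
    have := hB (Finsupp.mem_support_iff.2 hc)
    omega
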